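/- arXiv:1804.03759 — 4 statements merged into one kernel-verified Lean document; each statement's English description precedes it below -/
import Mathlib

section
/- Every finite connected block graph (in particular, every finite tree and every complete graph) is a ZV-line graph with respect to some ZV-ordered partition; moreover, the cycle C_4 on four vertices is a ZV-line graph with respect to some ZV-ordered partition. -/
/- Common framework: finite connected simple graphs, shortest-path distance,
   profiles as lists of vertices, mechanisms as functions `List α → α`,
   anonymity, Pareto optimality, and group-manipulation-resistance. -/

open Classical

noncomputable section

/-- The ball of radius `r` around `v`. -/
def ball {α : Type} (G : SimpleGraph α) (v : α) (r : ℕ) : Set α :=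
  {u | G.dist v u ≤ r}

/-- Distance from a vertex to a (nonempty) set of vertices. -/
def distToSet {α : Type} (G : SimpleGraph α) (v : α) (Z : Finset α) : ℕ :=
  sInf ((fun z => G.dist v z) '' (Z : Set α))

/-- An agent located at `ℓ` weakly prefers `a` over `b`. -/
def wPref {α : Type} (G : SimpleGraph α) (ℓ a b : α) : Prop := G.dist ℓ a ≤ G.dist ℓ b

/-- An agent located at `ℓ` strictly prefers `a` over `b`. -/
def sPref {α : Type} (G : SimpleGraph α) (ℓ a b : α) : Prop := G.dist ℓ a < G.dist ℓ b

/-- `u` Pareto dominates `v` w.r.t. the profile `x`. -/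
def Dominates {α : Type} (G : SimpleGraph α) (x : List α) (u v : α) : Prop :=
  (∀ a ∈ x, wPref G a u v) ∧ (∃ a ∈ x, sPref G a u v)

/-- The set of Pareto optimal locations for a profile `x`. -/
def PO {α : Type} (G : SimpleGraph α) (x : List α) : Set α :=
  {v | ¬ ∃ u, Dominates G x u v}

/-- A mechanism is anonymous if its outcome is invariant under permutations of ballots. -/
def Anonymous {α : Type} (F : List α → α) : Prop :=
  ∀ x y : List α, x.Perm y → F x = F y

/-- A mechanism is Pareto optimal if its outcome is always Pareto optimal. -/
def ParetoOptimal {α : Type} (G : SimpleGraph α) (F : List α → α) : Prop :=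
  ∀ x : List α, F x ∈ PO G x

/-- The list of ballots `x j` for agents `j` outside the coalition `C`. -/
def profileMinus {α : Type} {n : ℕ} (x : Fin n → α) (C : Finset (Fin n)) : List α :=
  ((List.finRange n).filter (fun i => decide (i ∉ C))).map x

/-- Group-manipulation-resistance where all sincere ballots and all manipulated
ballots are required to lie in the set `S`. -/
def GMRon {α : Type} (G : SimpleGraph α) (S : Set α) (F : List α → α) : Prop :=
  ¬ ∃ (n : ℕ) (x : Fin n → α) (C : Finset (Fin n)) (A : List α),
      (∀ i, x i ∈ S) ∧ (∀ a ∈ A, a ∈ S) ∧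
      (∀ i ∈ C, wPref G (x i) (F (A ++ profileMinus x C)) (F (List.ofFn x))) ∧
      (∃ i ∈ C, sPref G (x i) (F (A ++ profileMinus x C)) (F (List.ofFn x)))

/-- Group-manipulation-resistance: no coalition `C` can, by replacing its ballots
with an arbitrary finite tuple `A` of ballots (misreporting, false-name voting,
or abstaining), obtain an outcome that all its members weakly prefer and at least
one member strictly prefers. -/
def GMR {α : Type} (G : SimpleGraph α) (F : List α → α) : Prop :=
  ¬ ∃ (n : ℕ) (x : Fin n → α) (C : Finset (Fin n)) (A : List α),
      (∀ i ∈ C, wPref G (x i) (F (A ++ profileMinus x C)) (F (List.ofFn x))) ∧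
      (∃ i ∈ C, sPref G (x i) (F (A ++ profileMinus x C)) (F (List.ofFn x)))

/-- `A` is an interval in `Z` (w.r.t. the order injection `ord`): it is a subset
of `Z` that is order-convex within `Z`. -/
def IsIntervalIn {α : Type} (ord : α → ℝ) (Z : Finset α) (A : Set α) : Prop :=
  A ⊆ (Z : Set α) ∧
  ∀ a ∈ A, ∀ b ∈ A, ∀ c ∈ Z, ord a ≤ ord c → ord c ≤ ord b → c ∈ A

/-- A ZV-ordered partition ⟨Z, V₁, …, V_k⟩ of a connected graph `G`, together with
the order (injection into ℝ) on `Z` and the roots of the `Vᵢ`. -/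
structure ZVPartition {α : Type} (G : SimpleGraph α) where
  hconn : G.Connected
  k : ℕ
  Z : Finset α
  Vs : Fin k → Finset α
  ord : α → ℝ
  Z_nonempty : Z.Nonempty
  Vs_nonempty : ∀ i, (Vs i).Nonempty
  ord_inj : Set.InjOn ord (Z : Set α)
  Vs_disjoint : ∀ i j, i ≠ j → Disjoint (Vs i) (Vs j)
  cover : ∀ v : α, v ∈ Z ∨ ∃ i, v ∈ Vs i
  no_drop_Z : ¬ ∀ v : α, ∃ i, v ∈ Vs i
  no_drop_Vs : ∀ i : Fin k, ¬ ∀ v : α, v ∈ Z ∨ ∃ j, j ≠ i ∧ v ∈ Vs j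
  root : Fin k → α
  root_mem : ∀ i, root i ∈ Vs i
  root_min : ∀ i, ∀ u ∈ Vs i, distToSet G (root i) Z ≤ distToSet G u Z
  root_unique : ∀ i, ∀ u ∈ Vs i, (∀ w ∈ Vs i, distToSet G u Z ≤ distToSet G w Z) → u = root i
  separation : ∀ i : Fin k, ∀ u ∈ Vs i, ∀ v : α, v ∉ Vs i →
      ∀ p : G.Walk u v, root i ∈ p.support ∧ ∃ z ∈ Z, z ∈ p.support

/-- `G` is a ZV-line graph w.r.t. the ZV-ordered partition `P`: balls of radius 1
around Z-vertices meet `Z` in intervals, each induced subgraph on `Vᵢ` is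
recursively a ZV-line graph whose Z-set contains the root of `Vᵢ` as its leftmost
element, and balls of radius 1 around the roots meet `Z` in intervals. -/
inductive IsZVLineGraph : {β : Type} → {H : SimpleGraph β} → ZVPartition H → Prop
  | mk {β : Type} {H : SimpleGraph β} (P : ZVPartition H)
      (hb : ∀ z ∈ P.Z, IsIntervalIn P.ord P.Z (ball H z 1 ∩ (P.Z : Set β)))
      (Q : ∀ i : Fin P.k, ZVPartition (H.induce ((P.Vs i : Finset β) : Set β)))
      (hQ : ∀ i, IsZVLineGraph (Q i))
      (hroot : ∀ i : Fin P.k, ∃ h : P.root i ∈ ((P.Vs i : Finset β) : Set β),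
          (⟨P.root i, h⟩ : ((P.Vs i : Finset β) : Set β)) ∈ (Q i).Z ∧
          ∀ z ∈ (Q i).Z, (Q i).ord ⟨P.root i, h⟩ ≤ (Q i).ord z)
      (hballroot : ∀ i, IsIntervalIn P.ord P.Z (ball H (P.root i) 1 ∩ (P.Z : Set β))) :
      IsZVLineGraph P

/-- A block graph: for every four vertices, the two larger of the three pairwise
distance sums are equal. -/
def IsBlockGraph {α : Type} (G : SimpleGraph α) : Prop :=
  ∀ u v w x : α,
    (G.dist u v + G.dist w x ≤ G.dist u w + G.dist v x →
     G.dist u v + G.dist w x ≤ G.dist u x + G.dist v w →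
     G.dist u w + G.dist v x = G.dist u x + G.dist v w) ∧
    (G.dist u w + G.dist v x ≤ G.dist u v + G.dist w x →
     G.dist u w + G.dist v x ≤ G.dist u x + G.dist v w →
     G.dist u v + G.dist w x = G.dist u x + G.dist v w) ∧
    (G.dist u x + G.dist v w ≤ G.dist u v + G.dist w x →
     G.dist u x + G.dist v w ≤ G.dist u w + G.dist v x →
     G.dist u v + G.dist w x = G.dist u w + G.dist v x)

/-- The cycle graph on `ZMod n`: vertices `i` and `i + 1` (mod `n`) are adjacent. -/
def cycleG (n : ℕ) : SimpleGraph (ZMod n) :=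
  SimpleGraph.fromRel (fun a b => b = a + 1)

/-- Two neighbours of a vertex `v` joined by a walk avoiding `v` are equal or adjacent. -/
def NeighborsJoin {α : Type} (G : SimpleGraph α) : Prop :=
  ∀ ⦃v x y : α⦄, G.Adj v x → G.Adj v y → ∀ p : G.Walk x y, v ∉ p.support → x = y ∨ G.Adj x y

theorem IsBlockGraph.neighborsJoin {α : Type} {G : SimpleGraph α} (hc : G.Connected)
    (hG : IsBlockGraph G) : NeighborsJoin G := by
  have key : ∀ (v x y : α) (p : G.Walk x y), v ∉ p.support →
      G.dist x y < G.dist x v + G.dist v y := by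
    intro v x y p
    induction p with
    | @nil u =>
      intro hv
      have hne : u ≠ v := by rintro rfl; simp at hv
      have := hc.pos_dist_of_ne hne
      simp only [SimpleGraph.dist_self]
      omega
    | @cons u w t h q ih =>
      intro hv
      simp only [SimpleGraph.Walk.support_cons, List.mem_cons, not_or] at hv
      have h1 := ih hv.2
      have hwv : w ≠ v := by rintro rfl; exact hv.2 q.start_mem_support
      have h2 := SimpleGraph.dist_eq_one_iff_adj.2 h
      have h3 := hc.pos_dist_of_ne (Ne.symm hv.1)
      have h4 := hc.pos_dist_of_ne hwv
      have h5 := hG u t v w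
      have h6 : G.dist v w = G.dist w v := SimpleGraph.dist_comm
      have h7 : G.dist t v = G.dist v t := SimpleGraph.dist_comm
      have h8 : G.dist t w = G.dist w t := SimpleGraph.dist_comm
      have h9 := hc.dist_triangle (u := u) (v := v) (w := t)
      omega
  intro v x y hx hy p hp
  have h := key v x y p hp
  rw [SimpleGraph.dist_eq_one_iff_adj.2 hx.symm, SimpleGraph.dist_eq_one_iff_adj.2 hy] at h
  rcases (by omega : G.dist x y = 0 ∨ G.dist x y = 1) with h0 | h1
  · exact Or.inl (hc.dist_eq_zero_iff.1 h0)
  · exact Or.inr (SimpleGraph.dist_eq_one_iff_adj.1 h1)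

theorem SimpleGraph.IsAcyclic.neighborsJoin {α : Type} {G : SimpleGraph α} (hG : G.IsAcyclic) :
    NeighborsJoin G := by
  intro v x y hx hy p hp
  by_contra! hne
  have hp' : v ∉ p.bypass.support := fun h => hp (p.support_bypass_subset_support h)
  have h1 : (SimpleGraph.Walk.cons hx p.bypass).IsPath :=
    (SimpleGraph.Walk.cons_isPath_iff _ _).2 ⟨p.bypass_isPath, hp'⟩
  have h2 : (SimpleGraph.Walk.cons hy SimpleGraph.Walk.nil).IsPath :=
    (SimpleGraph.Walk.cons_isPath_iff _ _).2 ⟨SimpleGraph.Walk.IsPath.nil, by simpa using hy.ne⟩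
  have h3 := congrArg (fun w : G.Path v y => (w : G.Walk v y).support)
    ((hG.subsingleton_path v y).elim ⟨_, h1⟩ ⟨_, h2⟩)
  have h4 : x ∈ (SimpleGraph.Walk.cons hx p.bypass).support := by simp
  simp only at h3
  rw [h3] at h4
  simp [hx.ne', hne.1] at h4

theorem NeighborsJoin.induce {α : Type} {G : SimpleGraph α} (hG : NeighborsJoin G) (s : Set α) :
    NeighborsJoin (G.induce s) := by
  intro v x y hx hy p hp
  let f := (SimpleGraph.Embedding.induce (G := G) s)
  have hp' : (v : α) ∉ (p.map f.toHom).support := by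
    rw [SimpleGraph.Walk.support_map]
    intro h
    obtain ⟨u, hu, huv⟩ := List.mem_map.1 h
    exact hp (Subtype.ext huv ▸ hu)
  rcases hG (v := v) (x := x) (y := y) hx hy (p.map f.toHom) hp' with h | h
  · exact Or.inl (Subtype.ext h)
  · exact Or.inr h

/-- A connected vertex set containing every common neighbour of its edges, ordered from its
leftmost element `r` to its rightmost element `a` with unit balls being intervals. -/
structure IsBlockChain {α : Type} (G : SimpleGraph α) (r a : α) (Z : Finset α) (ord : α → ℝ) :
    Prop where
  left_mem : r ∈ Z
  right_mem : a ∈ Z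
  left_le : ∀ z ∈ Z, ord r ≤ ord z
  le_right : ∀ z ∈ Z, ord z ≤ ord a
  inj : Set.InjOn ord (Z : Set α)
  closed : ∀ z ∈ Z, ∀ z' ∈ Z, G.Adj z z' → ∀ w, G.Adj z w → G.Adj z' w → w ∈ Z
  conn : ∀ z ∈ Z, ∃ p : G.Walk z r, ∀ x ∈ p.support, x ∈ Z
  interval : ∀ z ∈ Z, ∀ x ∈ Z, ∀ y ∈ Z, ∀ c ∈ Z, (z = x ∨ G.Adj z x) → (z = y ∨ G.Adj z y) →
    ord x ≤ ord c → ord c ≤ ord y → z = c ∨ G.Adj z c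

namespace IsBlockChain

variable {α : Type} {G : SimpleGraph α} {r a : α} {Z : Finset α} {ord : α → ℝ}

theorem singleton (r : α) : IsBlockChain G r r {r} (fun _ => 0) where
  left_mem := by simp
  right_mem := by simp
  left_le := by simp
  le_right := by simp
  inj := by simp
  closed := by simp
  conn := by
    intro z hz
    obtain rfl := Finset.mem_singleton.1 hz
    exact ⟨SimpleGraph.Walk.nil, by simp⟩
  interval := by simp_all

theorem exists_path (h : IsBlockChain G r a Z ord) {z z' : α} (hz : z ∈ Z) (hz' : z' ∈ Z) :
    ∃ p : G.Walk z z', p.IsPath ∧ ∀ x ∈ p.support, x ∈ Z := by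
  obtain ⟨p, hp⟩ := h.conn z hz
  obtain ⟨q, hq⟩ := h.conn z' hz'
  refine ⟨(p.append q.reverse).bypass, SimpleGraph.Walk.bypass_isPath _, fun x hx => ?_⟩
  have := SimpleGraph.Walk.support_bypass_subset_support _ hx
  rw [SimpleGraph.Walk.mem_support_append_iff] at this
  rcases this with h1 | h1
  · exact hp x h1
  · exact hq x (by simpa using h1)

/-- A vertex outside the chain adjacent to `z` cannot reach another element of the chain first. -/
theorem eq_of_adj (h : IsBlockChain G r a Z ord) (hG : NeighborsJoin G) {z z' k : α}
    (hz : z ∈ Z) (hz' : z' ∈ Z) (hk : k ∉ Z) (hzk : G.Adj z k) (p : G.Walk k z')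
    (hp : ∀ x ∈ p.support, x ∈ Z → x = z') : z = z' := by
  by_contra hne
  obtain ⟨q, hq, hqZ⟩ := h.exists_path hz hz'
  cases q with
  | nil => exact hne rfl
  | @cons _ y _ hy q =>
    rw [SimpleGraph.Walk.cons_isPath_iff] at hq
    have hyZ : y ∈ Z := hqZ y (by simp)
    have hmem : z ∉ (p.append q.reverse).support := by
      rw [SimpleGraph.Walk.mem_support_append_iff]
      rintro (h1 | h1)
      · exact hne (hp z h1 hz)
      · exact hq.2 (by simpa using h1)
    rcases hG hzk hy (p.append q.reverse) hmem with h1 | h1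
    · exact hk (h1 ▸ hyZ)
    · exact hk (h.closed z hz y hyZ hy k hzk h1.symm)

theorem exists_extension [Fintype α] (h : IsBlockChain G r a Z ord) (hG : NeighborsJoin G)
    {b : α} (hab : G.Adj a b) (hb : b ∉ Z) :
    ∃ (Z' : Finset α) (ord' : α → ℝ), IsBlockChain G r b Z' ord' ∧ Z.card < Z'.card := by
  let N : Finset α := Finset.univ.filter fun w => w ∉ Z ∧ G.Adj a w ∧ (w = b ∨ G.Adj w b)
  have hN : ∀ w, w ∈ N ↔ w ∉ Z ∧ G.Adj a w ∧ (w = b ∨ G.Adj w b) := fun w => by simp [N]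
  have hbN : b ∈ N := (hN b).2 ⟨hb, hab, Or.inl rfl⟩
  let idx : α → ℝ := fun w => ((Fintype.equivFin α w : Fin _) : ℕ)
  have idx_nonneg : ∀ w, 0 ≤ idx w := fun w => Nat.cast_nonneg _
  have idx_lt : ∀ w, idx w < Fintype.card α := fun w =>
    Nat.cast_lt.2 (Fintype.equivFin α w).isLt
  have idx_inj : Function.Injective idx := fun w w' hw =>
    (Fintype.equivFin α).injective (Fin.ext (Nat.cast_injective hw))
  let ord' : α → ℝ := fun w =>
    if w ∈ Z then ord w else if w = b then ord a + 1 + Fintype.card α else ord a + 1 + idx w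
  have ord_old : ∀ w ∈ Z, ord' w = ord w := fun w hw => if_pos hw
  have ord_b : ord' b = ord a + 1 + Fintype.card α := by simp [ord', hb]
  have ord_new : ∀ w, w ∉ Z → w ≠ b → ord' w = ord a + 1 + idx w := fun w hw hwb => by
    simp [ord', hw, hwb]
  have ord_gt : ∀ w, w ∉ Z → ord a < ord' w := by
    intro w hw
    by_cases hwb : w = b
    · rw [hwb, ord_b]
      have : (0 : ℝ) ≤ Fintype.card α := Nat.cast_nonneg _
      linarith
    · rw [ord_new w hw hwb]
      linarith [idx_nonneg w]
  have ord_le : ∀ w, ord' w ≤ ord' b := by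
    intro w
    by_cases hw : w ∈ Z
    · rw [ord_old w hw]
      exact (h.le_right w hw).trans (ord_gt b hb).le
    · by_cases hwb : w = b
      · rw [hwb]
      · rw [ord_new w hw hwb, ord_b]
        linarith [idx_lt w]
  have adj_old : ∀ z ∈ Z, ∀ w ∈ N, G.Adj z w → z = a := by
    intro z hz w hw hzw
    have hw' := (hN w).1 hw
    refine h.eq_of_adj hG hz h.right_mem hw'.1 hzw hw'.2.1.symm.toWalk ?_
    intro x hx hxZ
    simp only [SimpleGraph.Adj.toWalk, SimpleGraph.Walk.support_cons,
      SimpleGraph.Walk.support_nil, List.mem_cons, List.not_mem_nil, or_false] at hx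
    rcases hx with rfl | rfl
    · exact absurd hxZ hw'.1
    · rfl
  have two_step : ∀ {v x y z : α}, G.Adj v x → G.Adj v y → G.Adj x z → G.Adj z y → v ≠ z →
      x = y ∨ G.Adj x y := by
    intro v x y z hx hy hxz hzy hvz
    refine hG hx hy (SimpleGraph.Walk.cons hxz hzy.toWalk) ?_
    simp [hx.ne, hy.ne, hvz]
  have clique : ∀ w ∈ N, ∀ w' ∈ N, w = w' ∨ G.Adj w w' := by
    intro w hw w' hw'
    rw [hN] at hw hw'
    rcases hw.2.2 with rfl | h1
    · rcases hw'.2.2 with h2 | h2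
      · exact Or.inl h2.symm
      · exact Or.inr h2.symm
    · rcases hw'.2.2 with rfl | h2
      · exact Or.inr h1
      · exact two_step hw.2.1 hw'.2.1 h1 h2.symm hab.ne
  have closed_right : ∀ z ∈ N, ∀ w, G.Adj a w → G.Adj z w → w ∈ Z ∪ N := by
    intro z hz w haw hzw
    rw [Finset.mem_union, or_iff_not_imp_left]
    intro hwZ
    have hz' := (hN z).1 hz
    refine (hN w).2 ⟨hwZ, haw, ?_⟩
    rcases hz'.2.2 with rfl | h1
    · exact Or.inr hzw.symm
    · exact two_step haw hab hzw.symm h1 hz'.2.1.ne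
  refine ⟨Z ∪ N, ord', ⟨?_, ?_, ?_, ?_, ?_, ?_, ?_, ?_⟩, ?_⟩
  · exact Finset.mem_union_left _ h.left_mem
  · exact Finset.mem_union_right _ hbN
  · intro z _
    rw [ord_old r h.left_mem]
    by_cases hzZ : z ∈ Z
    · rw [ord_old z hzZ]
      exact h.left_le z hzZ
    · exact (h.left_le a h.right_mem).trans (ord_gt z hzZ).le
  · exact fun z _ => ord_le z
  · intro x _ y _ hxy
    by_cases hxZ : x ∈ Z <;> by_cases hyZ : y ∈ Z
    · rw [ord_old x hxZ, ord_old y hyZ] at hxy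
      exact h.inj hxZ hyZ hxy
    · have h1 := ord_gt y hyZ
      have h2 := h.le_right x hxZ
      rw [ord_old x hxZ] at hxy
      linarith
    · have h1 := ord_gt x hxZ
      have h2 := h.le_right y hyZ
      rw [ord_old y hyZ] at hxy
      linarith
    · by_cases hxb : x = b <;> by_cases hyb : y = b
      · rw [hxb, hyb]
      · rw [hxb, ord_b, ord_new y hyZ hyb] at hxy
        linarith [idx_lt y]
      · rw [hyb, ord_b, ord_new x hxZ hxb] at hxy
        linarith [idx_lt x]
      · rw [ord_new x hxZ hxb, ord_new y hyZ hyb] at hxy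
        exact idx_inj (by linarith)
  · intro z hz z' hz' hzz' w hw hw'
    rcases Finset.mem_union.1 hz with hz | hz <;> rcases Finset.mem_union.1 hz' with hz' | hz'
    · exact Finset.mem_union_left _ (h.closed z hz z' hz' hzz' w hw hw')
    · obtain rfl := adj_old z hz z' hz' hzz'
      exact closed_right z' hz' w hw hw'
    · obtain rfl := adj_old z' hz' z hz hzz'.symm
      exact closed_right z hz w hw' hw
    · have h1 := (hN z).1 hz
      have h2 := (hN z').1 hz'
      rcases two_step hw h1.2.1.symm hw'.symm h2.2.1.symm hzz'.ne with rfl | h3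
      · exact Finset.mem_union_left _ h.right_mem
      · exact closed_right z hz w h3.symm hw
  · intro z hz
    rcases Finset.mem_union.1 hz with hz | hz
    · obtain ⟨p, hp⟩ := h.conn z hz
      exact ⟨p, fun x hx => Finset.mem_union_left _ (hp x hx)⟩
    · obtain ⟨p, hp⟩ := h.conn a h.right_mem
      refine ⟨SimpleGraph.Walk.cons ((hN z).1 hz).2.1.symm p, fun x hx => ?_⟩
      rw [SimpleGraph.Walk.support_cons, List.mem_cons] at hx
      rcases hx with rfl | hx
      · exact Finset.mem_union_right _ hz
      · exact Finset.mem_union_left _ (hp x hx)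
  · intro z hz x hx y hy c hc hzx hzy hxc hcy
    have old_of_le : ∀ u v, v ∈ Z → ord' u ≤ ord' v → u ∈ Z := by
      intro u v hv huv
      by_contra hu
      have h1 := ord_gt u hu
      have h2 := h.le_right v hv
      rw [ord_old v hv] at huv
      linarith
    by_cases hza : z = a
    · subst hza
      rcases Finset.mem_union.1 hc with hcZ | hcN
      · have hx' := old_of_le x c hcZ hxc
        rw [ord_old x hx', ord_old c hcZ] at hxc
        exact h.interval z h.right_mem x hx' z h.right_mem c hcZ hzx (Or.inl rfl) hxc
          (h.le_right c hcZ)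
      · exact Or.inr ((hN c).1 hcN).2.1
    rcases Finset.mem_union.1 hz with hz | hz
    · have stay : ∀ u ∈ Z ∪ N, (z = u ∨ G.Adj z u) → u ∈ Z := by
        rintro u hu (rfl | hzu)
        · exact hz
        · rcases Finset.mem_union.1 hu with hu | hu
          · exact hu
          · exact absurd (adj_old z hz u hu hzu) hza
      have hx' := stay x hx hzx
      have hy' := stay y hy hzy
      have hc' := old_of_le c y hy' hcy
      rw [ord_old x hx', ord_old c hc'] at hxc
      rw [ord_old y hy', ord_old c hc'] at hcy
      exact h.interval z hz x hx' y hy' c hc' hzx hzy hxc hcy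
    · rcases Finset.mem_union.1 hc with hcZ | hcN
      · have hx' := old_of_le x c hcZ hxc
        have hzx' : G.Adj z x := hzx.resolve_left fun e => ((hN z).1 hz).1 (e ▸ hx')
        obtain rfl := adj_old x hx' z hz hzx'.symm
        rw [ord_old x hx', ord_old c hcZ] at hxc
        rw [← h.inj hx' hcZ (le_antisymm hxc (h.le_right c hcZ))]
        exact Or.inr hzx'
      · exact clique z hz c hcN
  · refine Finset.card_lt_card (Finset.ssubset_iff_of_subset Finset.subset_union_left |>.2 ?_)
    exact ⟨b, Finset.mem_union_right _ hbN, hb⟩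

theorem exists_maximal [Fintype α] (hG : NeighborsJoin G) (r : α) :
    ∃ (a : α) (Z : Finset α) (ord : α → ℝ), IsBlockChain G r a Z ord ∧
      ∀ b, G.Adj a b → b ∈ Z := by
  by_contra! hcon
  have large : ∀ n : ℕ, ∃ (a : α) (Z : Finset α) (ord : α → ℝ),
      IsBlockChain G r a Z ord ∧ n ≤ Z.card := by
    intro n
    induction n with
    | zero => exact ⟨r, {r}, fun _ => 0, singleton r, Nat.zero_le _⟩
    | succ n ih =>
      obtain ⟨a, Z, ord, h, hn⟩ := ih
      obtain ⟨b, hab, hb⟩ := hcon a Z ord h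
      obtain ⟨Z', ord', h', hlt⟩ := h.exists_extension hG hab hb
      exact ⟨b, Z', ord', h', by omega⟩
  obtain ⟨a, Z, ord, -, hn⟩ := large (Fintype.card α + 1)
  have := Finset.card_le_univ Z
  omega

end IsBlockChain

/-- The vertices joined to `z` by a walk meeting `Z` at most in `z`. -/
def branch {α : Type} (G : SimpleGraph α) (Z : Finset α) (z : α) : Set α :=
  {v | ∃ p : G.Walk v z, ∀ x ∈ p.support, x ∈ Z → x = z}

section Branch

variable {α : Type} {G : SimpleGraph α} {Z : Finset α}

theorem self_mem_branch (z : α) : z ∈ branch G Z z :=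
  ⟨SimpleGraph.Walk.nil, by simp⟩

theorem eq_of_mem_branch_of_mem {z v : α} (hv : v ∈ branch G Z z) (hvZ : v ∈ Z) : v = z := by
  obtain ⟨p, hp⟩ := hv
  exact hp v p.start_mem_support hvZ

theorem mem_branch_of_adj {z u v : α} (huv : G.Adj u v) (hv : v ∈ branch G Z z) (hu : u ∉ Z) :
    u ∈ branch G Z z := by
  obtain ⟨p, hp⟩ := hv
  refine ⟨SimpleGraph.Walk.cons huv p, fun x hx hxZ => ?_⟩
  rw [SimpleGraph.Walk.support_cons, List.mem_cons] at hx
  rcases hx with rfl | hx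
  · exact absurd hxZ hu
  · exact hp x hx hxZ

theorem exists_mem_branch {v w : α} (p : G.Walk v w) (hw : w ∈ Z) : ∃ z ∈ Z, v ∈ branch G Z z := by
  induction p with
  | nil => exact ⟨_, hw, self_mem_branch _⟩
  | @cons u v w h q ih =>
    by_cases hu : u ∈ Z
    · exact ⟨u, hu, self_mem_branch u⟩
    · obtain ⟨z, hz, hv⟩ := ih hw
      exact ⟨z, hz, mem_branch_of_adj h hv hu⟩

theorem exists_adj_of_mem_branch {z v : α} (hv : v ∈ branch G Z z) (hne : v ≠ z) :
    ∃ k, G.Adj z k ∧ k ∉ Z ∧ ∃ q : G.Walk k v, ∀ x ∈ q.support, x ∉ Z := by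
  obtain ⟨p, hp⟩ := hv
  have hpath : p.bypass.reverse.IsPath := p.bypass_isPath.reverse
  have hsupp : ∀ x ∈ p.bypass.reverse.support, x ∈ Z → x = z := fun x hx =>
    hp x (p.support_bypass_subset_support (by simpa using hx))
  generalize p.bypass.reverse = q at hpath hsupp
  cases q with
  | nil => exact absurd rfl hne
  | @cons _ k _ h q =>
    rw [SimpleGraph.Walk.cons_isPath_iff] at hpath
    have hq : ∀ x ∈ q.support, x ∉ Z := fun x hx hxZ =>
      hpath.2 (hsupp x (by simp [hx]) hxZ ▸ hx)
    exact ⟨k, h, hq k q.start_mem_support, q, hq⟩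

theorem induce_branch_connected (z : α) : (G.induce (branch G Z z)).Connected := by
  refine SimpleGraph.induce_connected_of_patches z (self_mem_branch z) ?_
  rintro v ⟨p, hp⟩
  refine ⟨{x | x ∈ p.support}, ?_, p.end_mem_support, p.start_mem_support,
    p.connected_induce_support.preconnected _ _⟩
  intro x hx
  exact ⟨p.dropUntil x hx, fun y hy => hp y (p.support_dropUntil_subset_support hx hy)⟩

end Branch

namespace IsBlockChain

variable {α : Type} {G : SimpleGraph α} {r a : α} {Z : Finset α} {ord : α → ℝ}

theorem branch_unique (h : IsBlockChain G r a Z ord) (hG : NeighborsJoin G) {z z' v : α}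
    (hz : z ∈ Z) (hz' : z' ∈ Z) (hv : v ∈ branch G Z z) (hv' : v ∈ branch G Z z') : z = z' := by
  by_cases hvz : v = z
  · subst hvz
    exact eq_of_mem_branch_of_mem hv' hz
  · obtain ⟨k, hzk, hk, q, hq⟩ := exists_adj_of_mem_branch hv hvz
    obtain ⟨p, hp⟩ := hv'
    refine h.eq_of_adj hG hz hz' hk hzk (q.append p) fun x hx hxZ => ?_
    rw [SimpleGraph.Walk.mem_support_append_iff] at hx
    rcases hx with hx | hx
    · exact absurd hxZ (hq x hx)
    · exact hp x hx hxZ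

theorem mem_support_of_leaves_branch (h : IsBlockChain G r a Z ord) (hG : NeighborsJoin G)
    {z u v : α} (hz : z ∈ Z) (hu : u ∈ branch G Z z) (hv : v ∉ branch G Z z) (p : G.Walk u v) :
    z ∈ p.support := by
  induction p with
  | nil => exact absurd hu hv
  | @cons u w v huw q ih =>
    rw [SimpleGraph.Walk.support_cons, List.mem_cons]
    by_cases huz : u = z
    · exact Or.inl huz.symm
    refine Or.inr ?_
    have huZ : u ∉ Z := fun hmem => huz (eq_of_mem_branch_of_mem hu hmem)
    by_cases hwZ : w ∈ Z
    · have := h.branch_unique hG hwZ hz (mem_branch_of_adj huw (self_mem_branch w) huZ) hu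
      rw [← this]
      exact q.start_mem_support
    · exact ih (mem_branch_of_adj huw.symm hu hwZ) hv

end IsBlockChain

theorem mem_ball_one {α : Type} {G : SimpleGraph α} (hc : G.Connected) {z x : α} :
    x ∈ ball G z 1 ↔ z = x ∨ G.Adj z x := by
  rw [ball, Set.mem_ofPred_eq, Nat.le_one_iff_eq_zero_or_eq_one, hc.dist_eq_zero_iff,
    SimpleGraph.dist_eq_one_iff_adj]

theorem distToSet_eq_zero {α : Type} {G : SimpleGraph α} (hc : G.Connected) {Z : Finset α}
    (hZ : Z.Nonempty) {v : α} : distToSet G v Z = 0 ↔ v ∈ Z := by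
  rw [distToSet, Nat.sInf_eq_zero]
  constructor
  · rintro (⟨z, hz, h0⟩ | h)
    · rw [hc.dist_eq_zero_iff.1 h0]
      exact hz
    · obtain ⟨z, hz⟩ := hZ
      have : G.dist v z ∈ (fun z => G.dist v z) '' (Z : Set α) := ⟨z, hz, rfl⟩
      rw [h] at this
      exact this.elim
  · exact fun hv => Or.inl ⟨v, hv, SimpleGraph.dist_self⟩

/-- A connected graph with the block property is a ZV-line graph, with any prescribed vertex as
the leftmost element of the `Z`-set. -/
theorem NeighborsJoin.exists_ZVPartition {α : Type} [Fintype α] {G : SimpleGraph α}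
    (hc : G.Connected) (hG : NeighborsJoin G) (r : α) :
    ∃ P : ZVPartition G, IsZVLineGraph P ∧ r ∈ P.Z ∧ ∀ z ∈ P.Z, P.ord r ≤ P.ord z := by
  obtain ⟨n, hn⟩ : ∃ n, Fintype.card α = n := ⟨_, rfl⟩
  revert α
  induction n using Nat.strong_induction_on with
  | _ n ih =>
    intro α _ G hc hG r hn
    obtain ⟨a, Z, ord, h, hmax⟩ := IsBlockChain.exists_maximal hG r
    let I : Finset α := Z.filter fun z => ∃ v ∈ branch G Z z, v ≠ z
    have hI : ∀ z, z ∈ I ↔ z ∈ Z ∧ ∃ v ∈ branch G Z z, v ≠ z := fun z => by simp [I]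
    let e : Fin I.card ≃ I := I.equivFin.symm
    have hZ : ∀ i, (e i : α) ∈ Z := fun i => ((hI _).1 (e i).2).1
    let V : Fin I.card → Finset α := fun i => (branch G Z (e i)).toFinset
    have hV : ∀ i v, v ∈ V i ↔ v ∈ branch G Z (e i) := fun i v => by simp [V]
    have hdist : ∀ i, distToSet G (e i) Z = 0 := fun i =>
      (distToSet_eq_zero hc ⟨a, h.right_mem⟩).2 (hZ i)
    have hdisj : ∀ i j v, v ∈ V i → v ∈ V j → i = j := fun i j v hi hj =>
      e.injective (Subtype.ext
        (h.branch_unique hG (hZ i) (hZ j) ((hV i v).1 hi) ((hV j v).1 hj)))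
    have ha : ∀ i, a ∉ V i := by
      intro i hi
      have hai := eq_of_mem_branch_of_mem ((hV i a).1 hi) h.right_mem
      obtain ⟨-, v, hv, hne⟩ := (hI _).1 (e i).2
      rw [← hai] at hv hne
      obtain ⟨k, hak, hk, -⟩ := exists_adj_of_mem_branch hv hne
      exact hk (hmax k hak)
    have hball : ∀ z ∈ Z, IsIntervalIn ord Z (ball G z 1 ∩ (Z : Set α)) := by
      refine fun z hz => ⟨Set.inter_subset_right, ?_⟩
      rintro x ⟨hx, hxZ⟩ y ⟨hy, hyZ⟩ c hc' hxc hcy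
      exact ⟨(mem_ball_one hc).2 (h.interval z hz x hxZ y hyZ c hc' ((mem_ball_one hc).1 hx)
        ((mem_ball_one hc).1 hy) hxc hcy), hc'⟩
    let P : ZVPartition G :=
      { hconn := hc
        k := I.card
        Z := Z
        Vs := V
        ord := ord
        Z_nonempty := ⟨a, h.right_mem⟩
        Vs_nonempty := fun i => ⟨e i, (hV i _).2 (self_mem_branch _)⟩
        ord_inj := h.inj
        Vs_disjoint := fun i j hij =>
          Finset.disjoint_left.2 fun v hi hj => hij (hdisj i j v hi hj)
        cover := by
          intro v
          rw [or_iff_not_imp_left]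
          intro hvZ
          obtain ⟨p⟩ := hc.preconnected v a
          obtain ⟨z, hz, hv⟩ := exists_mem_branch p h.right_mem
          have hzI : z ∈ I := (hI z).2 ⟨hz, v, hv, fun hvz => hvZ (hvz ▸ hz)⟩
          refine ⟨e.symm ⟨z, hzI⟩, (hV _ v).2 ?_⟩
          simpa using hv
        no_drop_Z := fun hall => (hall a).elim ha
        no_drop_Vs := by
          intro i hall
          obtain ⟨-, v, hv, hne⟩ := (hI _).1 (e i).2
          rcases hall v with hvZ | ⟨j, hji, hj⟩
          · exact hne (eq_of_mem_branch_of_mem hv hvZ)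
          · exact hji (hdisj j i v hj ((hV i v).2 hv))
        root := fun i => e i
        root_mem := fun i => (hV i _).2 (self_mem_branch _)
        root_min := fun i u _ => (hdist i).trans_le (Nat.zero_le _)
        root_unique := by
          intro i u hu hmin
          have h0 := hmin (e i) ((hV i _).2 (self_mem_branch _))
          rw [hdist, Nat.le_zero, distToSet_eq_zero hc ⟨a, h.right_mem⟩] at h0
          exact eq_of_mem_branch_of_mem ((hV i u).1 hu) h0
        separation := by
          intro i u hu v hv p
          have hmem := h.mem_support_of_leaves_branch hG (hZ i) ((hV i u).1 hu)
            (fun hv' => hv ((hV i v).2 hv')) p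
          exact ⟨hmem, e i, hZ i, hmem⟩ }
    have hrec : ∀ i : Fin P.k, ∃ Q : ZVPartition (G.induce ((V i : Finset α) : Set α)),
        IsZVLineGraph Q ∧ ⟨P.root i, P.root_mem i⟩ ∈ Q.Z ∧
          ∀ z ∈ Q.Z, Q.ord ⟨P.root i, P.root_mem i⟩ ≤ Q.ord z := by
      intro i
      have hconn : (G.induce ((V i : Finset α) : Set α)).Connected := by
        have hset : ((V i : Finset α) : Set α) = branch G Z (e i) := by simp [V]
        rw [hset]
        exact induce_branch_connected _
      refine ih _ ?_ hconn (hG.induce _) _ rfl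
      rw [← hn]
      exact Fintype.card_lt_of_injective_of_notMem (b := a) Subtype.val Subtype.val_injective
        (by rintro ⟨x, hx⟩; exact ha i (hx ▸ x.2))
    exact ⟨P, IsZVLineGraph.mk P hball (fun i => (hrec i).choose)
      (fun i => (hrec i).choose_spec.1) (fun i => ⟨P.root_mem i, (hrec i).choose_spec.2⟩)
      (fun i => hball _ (hZ i)), h.left_mem, h.left_le⟩

theorem isIntervalIn_of_subset_pair {α : Type} {ord : α → ℝ} {x y : α} {Z : Finset α}
    (hxy : ord x < ord y) (hZ : ∀ c ∈ Z, c = x ∨ c = y) {A : Set α} (hA : A ⊆ (Z : Set α)) :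
    IsIntervalIn ord Z A := by
  refine ⟨hA, fun s hs t ht c hc hsc hct => ?_⟩
  have h1 := hZ s (hA hs)
  have h2 := hZ t (hA ht)
  rcases hZ c hc with rfl | rfl
  · rcases h1 with rfl | rfl
    · exact hs
    · linarith
  · rcases h2 with rfl | rfl
    · linarith
    · exact ht

theorem cycleG_four_adj {x y : ZMod 4} : (cycleG 4).Adj x y ↔ y = x + 1 ∨ y = x + 3 := by
  rw [cycleG, SimpleGraph.fromRel_adj]
  revert x y
  decide

theorem cycleG_four_connected : (cycleG 4).Connected := by
  have h0 : ∀ v : ZMod 4, (cycleG 4).Reachable 0 v := by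
    have step : ∀ v : ZMod 4, (cycleG 4).Reachable v (v + 1) := fun v =>
      (cycleG_four_adj.2 (Or.inl rfl)).reachable
    have h1 : (cycleG 4).Reachable 0 1 := step 0
    have h2 : (cycleG 4).Reachable 0 2 := h1.trans (step 1)
    have h3 : (cycleG 4).Reachable 0 3 := h2.trans (step 2)
    intro v
    have hv : v = 0 ∨ v = 1 ∨ v = 2 ∨ v = 3 := by revert v; decide
    rcases hv with rfl | rfl | rfl | rfl
    · exact SimpleGraph.Reachable.refl _
    · exact h1
    · exact h2
    · exact h3
  exact ⟨fun u v => (h0 u).symm.trans (h0 v)⟩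

theorem exists_ZVPartition_cycleG_four : ∃ P : ZVPartition (cycleG 4), IsZVLineGraph P := by
  let ρ : Fin 2 → ZMod 4 := ![1, 3]
  let ord : ZMod 4 → ℝ := fun v => v.val
  have hord : ord 0 < ord 2 := by
    have h0 : (0 : ZMod 4).val = 0 := rfl
    have h2 : (2 : ZMod 4).val = 2 := rfl
    simp only [ord, h0, h2]
    norm_num
  let P : ZVPartition (cycleG 4) :=
    { hconn := cycleG_four_connected
      k := 2
      Z := {0, 2}
      Vs := fun i => {ρ i}
      ord := ord
      Z_nonempty := ⟨0, by simp⟩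
      Vs_nonempty := fun i => ⟨ρ i, by simp⟩
      ord_inj := fun x _ y _ hxy => ZMod.val_injective 4 (Nat.cast_injective hxy)
      Vs_disjoint := by
        intro i j hij
        rw [Finset.disjoint_singleton]
        revert i j
        decide
      cover := by
        simp only [Finset.mem_insert, Finset.mem_singleton]
        decide
      no_drop_Z := by
        simp only [Finset.mem_singleton]
        decide
      no_drop_Vs := by
        simp only [Finset.mem_insert, Finset.mem_singleton]
        decide
      root := ρ
      root_mem := by simp
      root_min := by simp
      root_unique := by simp
      separation := by
        intro i u hu v hv p
        rw [Finset.mem_singleton] at hu hv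
        subst hu
        refine ⟨p.start_mem_support, ?_⟩
        cases p with
        | nil => exact absurd rfl hv
        | @cons _ w _ h q =>
          refine ⟨w, ?_, by simp⟩
          rw [cycleG_four_adj] at h
          simp only [Finset.mem_insert, Finset.mem_singleton]
          clear hv q
          revert i w
          decide }
  have hrec : ∀ i : Fin P.k,
      ∃ Q : ZVPartition ((cycleG 4).induce ((P.Vs i : Finset (ZMod 4)) : Set (ZMod 4))),
        IsZVLineGraph Q ∧ ⟨P.root i, P.root_mem i⟩ ∈ Q.Z ∧
          ∀ z ∈ Q.Z, Q.ord ⟨P.root i, P.root_mem i⟩ ≤ Q.ord z := by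
    intro i
    have hsub : ∀ x y : ((P.Vs i : Finset (ZMod 4)) : Set (ZMod 4)), x = y := fun x y =>
      Subtype.ext ((Finset.mem_singleton.1 x.2).trans (Finset.mem_singleton.1 y.2).symm)
    have : Nonempty ((P.Vs i : Finset (ZMod 4)) : Set (ZMod 4)) := ⟨⟨P.root i, P.root_mem i⟩⟩
    refine NeighborsJoin.exists_ZVPartition ⟨fun x y => ?_⟩ (fun _ x y _ _ _ _ => ?_) _
    · rw [hsub x y]
    · exact Or.inl (hsub x y)
  choose Q hQ hQmem hQle using hrec
  have hZ : ∀ c ∈ P.Z, c = 0 ∨ c = 2 := fun c hc => by simpa [P] using hc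
  exact ⟨P, IsZVLineGraph.mk P
    (fun _ _ => isIntervalIn_of_subset_pair hord hZ Set.inter_subset_right)
    Q hQ (fun i => ⟨P.root_mem i, hQmem i, hQle i⟩)
    (fun _ => isIntervalIn_of_subset_pair hord hZ Set.inter_subset_right)⟩

/-- Every finite connected block graph (in particular every
finite tree and every complete graph) is a ZV-line graph w.r.t. some ZV-ordered
partition; moreover the cycle `C₄` is a ZV-line graph w.r.t. some ZV-ordered
partition. -/
theorem blockGraphs_trees_cliques_and_C4_are_ZVLine :
    (∀ (α : Type) [Fintype α] (G : SimpleGraph α), G.Connected → IsBlockGraph G →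
        ∃ P : ZVPartition G, IsZVLineGraph P) ∧
    (∀ (α : Type) [Fintype α] (G : SimpleGraph α), G.IsTree →
        ∃ P : ZVPartition G, IsZVLineGraph P) ∧
    (∀ (α : Type) [Fintype α] [Nonempty α],
        ∃ P : ZVPartition (⊤ : SimpleGraph α), IsZVLineGraph P) ∧
    (∃ P : ZVPartition (cycleG 4), IsZVLineGraph P) := by
  refine ⟨?_, ?_, ?_, exists_ZVPartition_cycleG_four⟩
  · intro α _ G hc hG
    obtain ⟨r⟩ := hc.nonempty
    obtain ⟨P, hP, -⟩ := (hG.neighborsJoin hc).exists_ZVPartition hc r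
    exact ⟨P, hP⟩
  · intro α _ G hG
    obtain ⟨r⟩ := hG.connected.nonempty
    obtain ⟨P, hP, -⟩ := hG.isAcyclic.neighborsJoin.exists_ZVPartition hG.connected r
    exact ⟨P, hP⟩
  · intro α _ _
    have hjoin : NeighborsJoin (⊤ : SimpleGraph α) := fun _ x y _ _ _ _ => eq_or_ne x y
    obtain ⟨P, hP, -⟩ := hjoin.exists_ZVPartition SimpleGraph.connected_top
      (Classical.arbitrary α)
    exact ⟨P, hP⟩
end
end

section
/- Let G = (𝒱, E) be a finite connected simple graph and let F be a mechanism on G. If F is onto (for every vertex v ∈ 𝒱 there exists a location profile x with F(x) = v) and F is group-manipulation-resistant, then F is Pareto optimal. -/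
/- Common framework: finite connected simple graphs, shortest-path distance,
   profiles as lists of vertices, mechanisms as functions `List α → α`,
   anonymity, Pareto optimality, and group-manipulation-resistance. -/

open Classical

noncomputable section

/-- On a finite connected graph, every onto,
group-manipulation-resistant mechanism is Pareto optimal. -/
theorem pareto_of_onto_gmr
    {α : Type} [Fintype α] (G : SimpleGraph α) (hconn : G.Connected)
    (F : List α → α)
    (honto : ∀ v : α, ∃ x : List α, F x = v)
    (hgmr : GMR G F) :
    ParetoOptimal G F := by
  rintro x ⟨u, hall, a, ha, hlt⟩
  obtain ⟨A, rfl⟩ := honto u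
  refine hgmr ⟨x.length, x.get, Finset.univ, A, ?_, ?_⟩
  · intro i _
    simpa [profileMinus] using hall _ (x.get_mem i)
  · obtain ⟨i, rfl⟩ := List.mem_iff_get.mp ha
    exact ⟨i, Finset.mem_univ i, by simpa [profileMinus] using hlt⟩
end
end

section
/- Let m ≥ 1 and consider the discrete line graph on the locations {0, 1, …, m−1}. The median mechanism F, which maps each nonempty location profile x to the smallest location ℓ minimizing Σ_i |x_i − ℓ|, is anonymous and Pareto optimal, and it is resistant to misreporting and abstention both by individuals and by coalitions: there exist no profile x ∈ {0,…,m−1}^n, coalition C ⊆ {1,…,n}, and tuple of ballots A with 1 ≤ |A| ≤ |C| such that every agent in C weakly prefers F(A, x_{−C}) over F(x) and at least one agent in C strictly prefers F(A, x_{−C}) over F(x). -/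
/- The discrete line graph on the locations `{0, 1, …, m−1}` (represented as
`Fin m`), with graph distance `d(a,b) = |a − b|`. Profiles are lists of
locations; mechanisms are functions `List (Fin m) → Fin m`. -/

open Classical

noncomputable section

/-- Distance on the discrete line: `d(a,b) = |a − b|`. -/
def ldist {m : ℕ} (a b : Fin m) : ℕ := ((a : ℤ) - (b : ℤ)).natAbs

/-- An agent located at `ℓ` weakly prefers `a` over `b`. -/
def lwPref {m : ℕ} (ℓ a b : Fin m) : Prop := ldist ℓ a ≤ ldist ℓ b

/-- An agent located at `ℓ` strictly prefers `a` over `b`. -/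
def lsPref {m : ℕ} (ℓ a b : Fin m) : Prop := ldist ℓ a < ldist ℓ b

/-- `u` Pareto dominates `v` w.r.t. the profile `x`. -/
def lDominates {m : ℕ} (x : List (Fin m)) (u v : Fin m) : Prop :=
  (∀ a ∈ x, lwPref a u v) ∧ (∃ a ∈ x, lsPref a u v)

/-- The set of Pareto optimal locations for a profile `x`. -/
def lPO {m : ℕ} (x : List (Fin m)) : Set (Fin m) :=
  {v | ¬ ∃ u, lDominates x u v}

/-- A mechanism is anonymous if its outcome is invariant under permutations of ballots. -/
def lAnonymous {m : ℕ} (F : List (Fin m) → Fin m) : Prop :=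
  ∀ x y : List (Fin m), x.Perm y → F x = F y

/-- A mechanism is Pareto optimal if its outcome is always Pareto optimal. -/
def lParetoOptimal {m : ℕ} (F : List (Fin m) → Fin m) : Prop :=
  ∀ x : List (Fin m), F x ∈ lPO x

/-- The list of ballots `x j` for agents `j` outside the coalition `C`. -/
def lprofileMinus {m n : ℕ} (x : Fin n → Fin m) (C : Finset (Fin n)) : List (Fin m) :=
  ((List.finRange n).filter (fun i => decide (i ∉ C))).map x

/-- The total distance from the ballots of `x` to the location `ℓ`. -/
def lcost {m : ℕ} (x : List (Fin m)) (ℓ : Fin m) : ℕ :=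
  (x.map (fun a => ldist a ℓ)).sum

/-- `F` is the median mechanism: on every nonempty profile it returns the
smallest location minimizing the sum of distances to the ballots. -/
def MedianSpec {m : ℕ} (F : List (Fin m) → Fin m) : Prop :=
  ∀ x : List (Fin m), x ≠ [] →
    (∀ ℓ : Fin m, lcost x (F x) ≤ lcost x ℓ) ∧
    (∀ ℓ : Fin m, lcost x ℓ ≤ lcost x (F x) → F x ≤ ℓ)

theorem lcost_perm {m : ℕ} {x y : List (Fin m)} (h : x.Perm y) (ℓ : Fin m) :
    lcost x ℓ = lcost y ℓ :=
  (h.map _).sum_eq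

theorem lcost_add_length {m : ℕ} (x : List (Fin m)) (s r : Fin m) (h : (r : ℕ) = s + 1) :
    lcost x r + x.length = lcost x s + 2 * x.countP (fun a => decide (a < r)) := by
  induction x with
  | nil => simp [lcost]
  | cons a x ih =>
    simp only [lcost, List.map_cons, List.sum_cons, List.length_cons, List.countP_cons,
      decide_eq_true_eq, Fin.lt_def, ldist] at ih ⊢
    split_ifs <;> omega

theorem lcost_lt_of_lDominates {m : ℕ} {x : List (Fin m)} {u v : Fin m}
    (h : lDominates x u v) : lcost x u < lcost x v :=
  List.sum_lt_sum _ _ h.1 h.2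

namespace MedianSpec

variable {m : ℕ} {F : List (Fin m) → Fin m}

theorem anonymous (hF : MedianSpec F) : lAnonymous F := by
  intro x y h
  by_cases hx : x = []
  · subst hx
    rw [h.nil_eq]
  · have hy : y ≠ [] := fun hy => hx (by simpa [hy] using h)
    obtain ⟨hx₁, hx₂⟩ := hF x hx
    obtain ⟨hy₁, hy₂⟩ := hF y hy
    simp only [lcost_perm h] at hx₁ hx₂
    exact le_antisymm (hx₂ _ (hy₁ _)) (hy₂ _ (hx₁ _))

theorem paretoOptimal (hF : MedianSpec F) : lParetoOptimal F := by
  rintro x ⟨u, hu⟩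
  obtain ⟨a, ha, -⟩ := hu.2
  exact (lcost_lt_of_lDominates hu).not_ge ((hF x (List.ne_nil_of_mem ha)).1 u)

theorem length_le_of_lt (hF : MedianSpec F) {x : List (Fin m)} (hx : x ≠ []) {r : Fin m}
    (hr : F x < r) : x.length ≤ 2 * x.countP (fun a => decide (a < r)) := by
  have hs : (F x : ℕ) + 1 < m := by have := r.isLt; rw [Fin.lt_def] at hr; omega
  have hcost := lcost_add_length x (F x) ⟨F x + 1, hs⟩ rfl
  have hmin := (hF x hx).1 ⟨F x + 1, hs⟩
  have hmono : x.countP (fun a => decide (a < (⟨F x + 1, hs⟩ : Fin m)))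
      ≤ x.countP (fun a => decide (a < r)) := by
    refine List.countP_mono_left fun a _ ha => ?_
    simp only [decide_eq_true_eq, Fin.lt_def] at ha hr ⊢
    omega
  omega

theorem lt_length_of_le (hF : MedianSpec F) {x : List (Fin m)} (hx : x ≠ []) {r : Fin m}
    (hr : r ≤ F x) : 2 * x.countP (fun a => decide (a < r)) < x.length := by
  have hmono : x.countP (fun a => decide (a < r)) ≤ x.countP (fun a => decide (a < F x)) := by
    refine List.countP_mono_left fun a _ ha => ?_
    simp only [decide_eq_true_eq] at ha ⊢
    exact ha.trans_le hr
  by_cases h0 : (F x : ℕ) = 0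
  · have : x.countP (fun a => decide (a < F x)) = 0 := by
      simp [List.countP_eq_zero, Fin.le_def, h0]
    have := List.length_pos_iff.2 hx
    omega
  · have hs : (F x : ℕ) - 1 < m := by have := (F x).isLt; omega
    have hcost := lcost_add_length x ⟨F x - 1, hs⟩ (F x) (by simp only; omega)
    have hmin : ¬ lcost x ⟨F x - 1, hs⟩ ≤ lcost x (F x) := fun h => by
      have := (hF x hx).2 _ h
      rw [Fin.le_def] at this
      simp only at this
      omega
    omega

/-- If the voters in `S` replace their ballots by the at most as many ballots in `A`, and all of
them weakly prefer the new outcome, then the outcome has not changed. -/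
theorem eq_of_lwPref (hF : MedianSpec F) {S A R : List (Fin m)} (hA : A ≠ [])
    (hle : A.length ≤ S.length) (h : ∀ a ∈ S, lwPref a (F (A ++ R)) (F (S ++ R))) :
    F (A ++ R) = F (S ++ R) := by
  have hS : S ≠ [] := by
    rw [← List.length_pos_iff] at hA ⊢
    omega
  have hAR : A ++ R ≠ [] := by simp [hA]
  have hSR : S ++ R ≠ [] := by simp [hS]
  simp only [lwPref, ldist] at h
  rcases lt_trichotomy (F (A ++ R)) (F (S ++ R)) with hlt | heq | hlt
  · have hnew := hF.length_le_of_lt hAR hlt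
    have hold := hF.lt_length_of_le hSR le_rfl
    have hall : S.countP (fun a => decide (a < F (S ++ R))) = S.length := by
      rw [List.countP_eq_length]
      intro a ha
      have := h a ha
      simp only [decide_eq_true_eq, Fin.lt_def] at hlt ⊢
      omega
    have hsome := List.countP_le_length (p := fun a => decide (a < F (S ++ R))) (l := A)
    simp only [List.countP_append, List.length_append] at hnew hold
    omega
  · exact heq
  · have hr : (F (S ++ R) : ℕ) + 1 < m := by
      have := (F (A ++ R)).isLt
      rw [Fin.lt_def] at hlt
      omega
    have hold := hF.length_le_of_lt hSR (r := ⟨F (S ++ R) + 1, hr⟩) (by simp [Fin.lt_def])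
    have hnew := hF.lt_length_of_le hAR (r := ⟨F (S ++ R) + 1, hr⟩) (by
      rw [Fin.lt_def] at hlt
      simp only [Fin.le_def]
      omega)
    have hnone : S.countP (fun a => decide (a < (⟨F (S ++ R) + 1, hr⟩ : Fin m))) = 0 := by
      rw [List.countP_eq_zero]
      intro a ha
      have := h a ha
      simp only [decide_eq_true_eq, Fin.lt_def] at hlt ⊢
      omega
    simp only [List.countP_append, List.length_append] at hnew hold
    omega

end MedianSpec

/-- The list of sincere ballots `x j` for agents `j` in the coalition `C`. -/
def lprofileOn {m n : ℕ} (x : Fin n → Fin m) (C : Finset (Fin n)) : List (Fin m) :=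
  ((List.finRange n).filter (fun i => decide (i ∈ C))).map x

theorem length_lprofileOn {m n : ℕ} (x : Fin n → Fin m) (C : Finset (Fin n)) :
    (lprofileOn x C).length = C.card := by
  rw [lprofileOn, List.length_map,
    ← List.toFinset_card_of_nodup ((List.nodup_finRange n).filter _)]
  congr 1
  ext i
  simp

theorem lprofileOn_append_lprofileMinus_perm {m n : ℕ} (x : Fin n → Fin m)
    (C : Finset (Fin n)) : (lprofileOn x C ++ lprofileMinus x C).Perm (List.ofFn x) := by
  rw [lprofileOn, lprofileMinus, ← List.map_append, List.ofFn_eq_map]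
  refine List.Perm.map x ?_
  simpa using List.filter_append_perm (fun i => decide (i ∈ C)) (List.finRange n)

/-- On the discrete line `{0,…,m−1}` (`m ≥ 1`), the median
mechanism is anonymous and Pareto optimal, and it is resistant to misreporting
and abstention by individuals and coalitions: no coalition `C` can, by casting
between `1` and `|C|` ballots instead of its sincere ballots, obtain an outcome
all its members weakly prefer and at least one member strictly prefers. -/
theorem median_mechanism_properties (m : ℕ) (hm : 1 ≤ m)
    (F : List (Fin m) → Fin m) (hF : MedianSpec F) :
    lAnonymous F ∧ lParetoOptimal F ∧
    ¬ ∃ (n : ℕ) (x : Fin n → Fin m) (C : Finset (Fin n)) (A : List (Fin m)),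
        1 ≤ A.length ∧ A.length ≤ C.card ∧
        (∀ i ∈ C, lwPref (x i) (F (A ++ lprofileMinus x C)) (F (List.ofFn x))) ∧
        (∃ i ∈ C, lsPref (x i) (F (A ++ lprofileMinus x C)) (F (List.ofFn x))) := by
  refine ⟨hF.anonymous, hF.paretoOptimal, ?_⟩
  rintro ⟨n, x, C, A, hA, hAC, hweak, i, -, hstrict⟩
  rw [← hF.anonymous _ _ (lprofileOn_append_lprofileMinus_perm x C)] at hweak hstrict
  have heq := hF.eq_of_lwPref (S := lprofileOn x C) (R := lprofileMinus x C)
    (List.length_pos_iff.1 hA) (by rwa [length_lprofileOn]) (by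
      intro a ha
      obtain ⟨j, hj, rfl⟩ := List.mem_map.1 ha
      exact hweak j (by simpa using hj))
  rw [heq] at hstrict
  exact lt_irrefl _ hstrict
end
end

section
/- Consider the cycle C_5 with vertex set {0,1,2,3,4} and edges between i and i+1 (mod 5), and the linear priority order 0 ≺ 1 ≺ 4 ≺ 2 ≺ 3 on the vertices (so that, read around the cycle 0,1,2,3,4, the priorities are 1,2,4,5,3). Then the mechanism F mapping each nonempty location profile x to the ≺-first Pareto optimal vertex is anonymous, Pareto optimal, and group-manipulation-resistant. -/
/- Common framework: finite connected simple graphs, shortest-path distance,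
   profiles as lists of vertices, mechanisms as functions `List α → α`,
   anonymity, Pareto optimality, and group-manipulation-resistance. -/

open Classical

noncomputable section

/-- The priority rank realizing the order `0 ≺ 1 ≺ 4 ≺ 2 ≺ 3` on the vertices of
`C₅` (read around the cycle `0,1,2,3,4`, the priorities are `1,2,4,5,3`). -/
def rank5 : ZMod 5 → ℕ :=
  fun v => if v = 0 then 0 else if v = 1 then 1 else if v = 4 then 2 else if v = 2 then 3 else 4

/-- The explicit distance on `ZMod 5` viewed as a cycle. -/
def cycDist (u v : ZMod 5) : ℕ := min (u - v).val (v - u).val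

lemma cycleG_five_adj (u v : ZMod 5) : (cycleG 5).Adj u v ↔ cycDist u v = 1 := by
  simp only [cycleG, SimpleGraph.fromRel_adj]
  revert u v
  decide

lemma cycleG_five_dist (u v : ZMod 5) : (cycleG 5).dist u v = cycDist u v := by
  have cases : ∀ u v : ZMod 5, u = v ∧ cycDist u v = 0 ∨ cycDist u v = 1 ∨
      (u ≠ v ∧ cycDist u v = 2 ∧ ∃ w, cycDist u w = 1 ∧ cycDist w v = 1) := by decide
  rcases cases u v with ⟨rfl, h⟩ | h | ⟨hne, h, w, huw, hwv⟩
  · simp [h]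
  · rw [h, SimpleGraph.dist_eq_one_iff_adj, cycleG_five_adj, h]
  · rw [← cycleG_five_adj] at huw hwv
    let p : (cycleG 5).Walk u v := .cons huw (.cons hwv .nil)
    have hle : (cycleG 5).dist u v ≤ 2 := SimpleGraph.dist_le p
    have hpos : 0 < (cycleG 5).dist u v := p.reachable.pos_dist_of_ne hne
    have hone : (cycleG 5).dist u v ≠ 1 := by
      rw [Ne, SimpleGraph.dist_eq_one_iff_adj, cycleG_five_adj, h]
      decide
    omega

/-- `v` is Pareto optimal for the set `S` of occupied vertices of the 5-cycle. -/
def IsCycPareto (S : Finset (ZMod 5)) (v : ZMod 5) : Prop :=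
  ∀ u, (∀ s ∈ S, cycDist s u ≤ cycDist s v) → ∀ s ∈ S, cycDist s v ≤ cycDist s u

instance (S : Finset (ZMod 5)) (v : ZMod 5) : Decidable (IsCycPareto S v) := by
  unfold IsCycPareto
  infer_instance

/-- `v` is the Pareto optimal vertex of least rank for the set `S` of occupied vertices. -/
def IsFirstCycPareto (S : Finset (ZMod 5)) (v : ZMod 5) : Prop :=
  IsCycPareto S v ∧ ∀ w, rank5 w < rank5 v → ¬ IsCycPareto S w

instance (S : Finset (ZMod 5)) (v : ZMod 5) : Decidable (IsFirstCycPareto S v) := by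
  unfold IsFirstCycPareto
  infer_instance

lemma mem_PO_cycleG_five (x : List (ZMod 5)) (v : ZMod 5) :
    v ∈ PO (cycleG 5) x ↔ IsCycPareto x.toFinset v := by
  simp [PO, Dominates, wPref, sPref, cycleG_five_dist, IsCycPareto]

lemma rank5_injective : Function.Injective rank5 := by
  unfold rank5
  decide

/-- If everyone who leaves the set `S` of occupied vertices when it changes to `S'` weakly prefers
the new outcome, then nobody in `S` strictly prefers it. -/
lemma IsFirstCycPareto.not_improved : ∀ (S : Finset (ZMod 5)) (a : ZMod 5), IsFirstCycPareto S a →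
    ∀ (S' : Finset (ZMod 5)) (b : ZMod 5), IsFirstCycPareto S' b →
    (∀ s ∈ S, s ∉ S' → cycDist s b ≤ cycDist s a) → ∀ s ∈ S, cycDist s a ≤ cycDist s b := by
  decide +kernel

lemma mem_profileMinus {α : Type} {n : ℕ} {x : Fin n → α} {C : Finset (Fin n)} {i : Fin n}
    (hi : i ∉ C) : x i ∈ profileMinus x C :=
  List.mem_map.mpr ⟨i, by simp [hi], rfl⟩

/-- On the cycle `C₅` with priority order `0 ≺ 1 ≺ 4 ≺ 2 ≺ 3`,
the mechanism returning on each nonempty profile the `≺`-first Pareto optimal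
vertex is anonymous, Pareto optimal, and group-manipulation-resistant. -/
theorem C5_first_pareto_mechanism
    (F : List (ZMod 5) → ZMod 5)
    (hF : ∀ x : List (ZMod 5), x ≠ [] →
        F x ∈ PO (cycleG 5) x ∧ ∀ v ∈ PO (cycleG 5) x, rank5 (F x) ≤ rank5 v) :
    Anonymous F ∧ ParetoOptimal (cycleG 5) F ∧ GMR (cycleG 5) F := by
  have first : ∀ x : List (ZMod 5), x ≠ [] → IsFirstCycPareto x.toFinset (F x) := fun x hx =>
    ⟨(mem_PO_cycleG_five x _).mp (hF x hx).1, fun w hw hPO =>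
      absurd ((hF x hx).2 w ((mem_PO_cycleG_five x w).mpr hPO)) (not_le.mpr hw)⟩
  refine ⟨fun x y hxy => ?_, fun x => ?_, ?_⟩
  · rcases eq_or_ne x [] with rfl | hx
    · rw [hxy.nil_eq]
    · have hy : y ≠ [] := fun h => hx (by simpa [h] using hxy)
      have hfx := first x hx
      rw [List.toFinset_eq_of_perm x y hxy] at hfx
      have hfy := first y hy
      exact rank5_injective (le_antisymm
        (not_lt.mp fun h => hfx.2 _ h hfy.1) (not_lt.mp fun h => hfy.2 _ h hfx.1))
  · rcases eq_or_ne x [] with rfl | hx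
    · simp [PO, Dominates]
    · exact (hF x hx).1
  · rintro ⟨n, x, C, A, hweak, i, hi, hstrict⟩
    simp only [wPref, sPref, cycleG_five_dist] at hweak hstrict
    have hmem : x i ∈ (List.ofFn x).toFinset := by simp
    have hx : List.ofFn x ≠ [] := List.ne_nil_of_mem (List.mem_toFinset.mp hmem)
    have hleave : ∀ s ∈ (List.ofFn x).toFinset, s ∉ (A ++ profileMinus x C).toFinset →
        cycDist s (F (A ++ profileMinus x C)) ≤ cycDist s (F (List.ofFn x)) := by
      intro s hs hs'
      obtain ⟨j, rfl⟩ := (List.mem_ofFn' x s).mp (List.mem_toFinset.mp hs)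
      by_cases hj : j ∈ C
      · exact hweak j hj
      · exact absurd (List.mem_toFinset.mpr (List.mem_append_right A (mem_profileMinus hj))) hs'
    refine absurd hstrict (not_lt.mpr ?_)
    rcases eq_or_ne (A ++ profileMinus x C) [] with hnil | hne
    · exact (first _ hx).1 _ (fun s hs => hleave s hs (by simp [hnil])) _ hmem
    · exact IsFirstCycPareto.not_improved _ _ (first _ hx) _ _ (first _ hne) hleave _ hmem
end
end
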